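/- arXiv:1808.10314 — 2 statements merged into one kernel-verified Lean document; each statement's English description precedes it below -/
import Mathlib

section
/- For every integer q ≥ 2 and every SYK graph G, one has F(G) ≤ 1 + (q−1)·|V(G)|/2, i.e. δ(G) ≤ 1. -/
namespace SYK

/-- A pre-SYK graph: a finite nonempty vertex set `V`, darts `V × Fin q`
(`Fin q` standing for the strand labels `{1,…,q}`), a fixed-point-free
involutive fermionic pairing `ferm` of the darts, and a fixed-point-free
involutive disorder pairing `dis` of the vertices.  (Connectivity of the
fermionic multigraph is *not* required.) -/
structure PreGraph (q : ℕ) where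
  V : Type
  [fintypeV : Fintype V]
  [decEqV : DecidableEq V]
  [nonemptyV : Nonempty V]
  ferm : Equiv.Perm (V × Fin q)
  dis : Equiv.Perm V
  ferm_invol : ∀ d, ferm (ferm d) = d
  ferm_fpf : ∀ d, ferm d ≠ d
  dis_invol : ∀ v, dis (dis v) = v
  dis_fpf : ∀ v, dis v ≠ v

attribute [instance] PreGraph.fintypeV PreGraph.decEqV PreGraph.nonemptyV

variable {q : ℕ}

/-- The darts of a pre-SYK graph. -/
abbrev PreGraph.Dart (H : PreGraph q) : Type := H.V × Fin q

/-- Relabelling of darts induced by a map of vertices. -/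
def dartMap {q : ℕ} {α β : Type} (ι : α → β) (d : α × Fin q) : β × Fin q :=
  (ι d.1, d.2)

/-- The involution `π̂` on darts induced by the disorder pairing:
`π̂ (v, m) = (π v, m)`. -/
def PreGraph.dishat (H : PreGraph q) : Equiv.Perm H.Dart :=
  Equiv.prodCongr H.dis (Equiv.refl (Fin q))

/-- Adjacency of vertices in the fermionic multigraph `G₀`, where fermionic
lines having a dart in `S` are deleted. -/
def PreGraph.adj0Off (H : PreGraph q) (S : Set H.Dart) (v w : H.V) : Prop :=
  ∃ m m' : Fin q, (v, m) ∉ S ∧ H.ferm (v, m) = (w, m')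

/-- Adjacency of vertices in the fermionic multigraph `G₀`. -/
def PreGraph.adj0 (H : PreGraph q) : H.V → H.V → Prop :=
  H.adj0Off ∅

/-- Connectivity of the fermionic multigraph `G₀`. -/
def PreGraph.Conn0 (H : PreGraph q) : Prop :=
  ∀ v w : H.V, Relation.ReflTransGen H.adj0 v w

/-- Adjacency of vertices in the multigraph `G⁺` (one edge per fermionic line
and one edge per disorder line), where fermionic lines having a dart in `S`
are deleted. -/
def PreGraph.adjPlusOff (H : PreGraph q) (S : Set H.Dart) (v w : H.V) : Prop :=
  H.adj0Off S v w ∨ H.dis v = w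

/-- The subgroup of dart permutations generated by the fermionic pairing `τ`
and the induced disorder involution `π̂`; faces are its orbits. -/
def PreGraph.faceGroup (H : PreGraph q) : Subgroup (Equiv.Perm H.Dart) :=
  Subgroup.closure {H.ferm, H.dishat}

/-- Two darts lie in a common face. -/
def PreGraph.SameFace (H : PreGraph q) (d₁ d₂ : H.Dart) : Prop :=
  d₁ ∈ MulAction.orbit H.faceGroup d₂

/-- `F H`: the number of faces, i.e. of orbits of `⟨τ, π̂⟩` on the darts. -/
noncomputable def PreGraph.F (H : PreGraph q) : ℕ :=
  Nat.card (MulAction.orbitRel.Quotient H.faceGroup H.Dart)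

/-- The number of vertices `|V(H)|`. -/
noncomputable def PreGraph.nV (H : PreGraph q) : ℕ :=
  Nat.card H.V

/-- `δ(H) = F(H) − (q−1)·|V(H)|/2` (the division is exact: `|V(H)|` is even). -/
noncomputable def PreGraph.delta (H : PreGraph q) : ℤ :=
  (H.F : ℤ) - ((q : ℤ) - 1) * ((H.nV / 2 : ℕ) : ℤ)

/-- `e` is a fermionic line: the set of the two darts of a `τ`-orbit. -/
def PreGraph.IsLine (H : PreGraph q) (e : Set H.Dart) : Prop :=
  ∃ d : H.Dart, e = {d, H.ferm d}

/-- The fermionic lines `e₁` and `e₂` belong to a common face. -/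
def PreGraph.LinesShareFace (H : PreGraph q) (e₁ e₂ : Set H.Dart) : Prop :=
  ∃ d₁ ∈ e₁, ∃ d₂ ∈ e₂, H.SameFace d₁ d₂

/-- Deleting the fermionic lines with a dart in `S` disconnects `G₀`. -/
def PreGraph.Disconnects0 (H : PreGraph q) (S : Set H.Dart) : Prop :=
  ¬ ∀ v w : H.V, Relation.ReflTransGen (H.adj0Off S) v w

/-- Deleting the fermionic lines with a dart in `S` disconnects `G⁺`. -/
def PreGraph.DisconnectsPlus (H : PreGraph q) (S : Set H.Dart) : Prop :=
  ¬ ∀ v w : H.V, Relation.ReflTransGen (H.adjPlusOff S) v w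

/-- `{e₁, e₂}` is a 2-cut of the multigraph `G⁺`. -/
def PreGraph.TwoCutPlus (H : PreGraph q) (e₁ e₂ : Set H.Dart) : Prop :=
  H.DisconnectsPlus (e₁ ∪ e₂)

/-- `{e₁, e₂}` is a 2-cut of the fermionic multigraph `G₀`. -/
def PreGraph.TwoCut0 (H : PreGraph q) (e₁ e₂ : Set H.Dart) : Prop :=
  H.Disconnects0 (e₁ ∪ e₂)

/-- An SYK graph: a pre-SYK graph whose fermionic multigraph `G₀` is
connected. -/
structure Graph (q : ℕ) extends PreGraph q where
  conn : toPreGraph.Conn0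

/-- `G` is (a relabelling of) the minimal graph `G_min`: two vertices `a, b`
with `π a = b` and `τ (a, m) = (b, m)` for all `m`. -/
def Graph.IsMin (G : Graph q) : Prop :=
  ∃ a b : G.V, a ≠ b ∧ (∀ v : G.V, v = a ∨ v = b) ∧ G.dis a = b ∧
    ∀ m : Fin q, G.ferm (a, m) = (b, m)

/-- `G'` is obtained from `G` by a melonic move: two new vertices `x, y` with
`π x = y` are inserted on a fermionic line `{d, τ d}` of `G`; the strand
`⟨0, _⟩ : Fin q` plays the role of the label `1` of `{1,…,q}`. -/
def Graph.MelonicMove (G G' : Graph q) : Prop :=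
  ∃ (x y : G'.V) (ι : G.V → G'.V) (d : G.V × Fin q),
    Function.Injective ι ∧ x ≠ y ∧
    (∀ v' : G'.V, (¬ ∃ v, ι v = v') ↔ (v' = x ∨ v' = y)) ∧
    G'.dis x = y ∧
    (∀ v, G'.dis (ι v) = ι (G.dis v)) ∧
    G'.ferm (dartMap ι d) = (x, ⟨0, d.2.pos⟩) ∧
    G'.ferm (y, ⟨0, d.2.pos⟩) = dartMap ι (G.ferm d) ∧
    (∀ k : Fin q, k ≠ ⟨0, d.2.pos⟩ → G'.ferm (x, k) = (y, k)) ∧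
    (∀ d' : G.V × Fin q, d' ≠ d → d' ≠ G.ferm d →
      G'.ferm (dartMap ι d') = dartMap ι (G.ferm d'))

/-- Isomorphism of SYK graphs: a bijection of darts commuting with the
fermionic pairings and the induced disorder involutions, and mapping the `q`
darts of each vertex onto the `q` darts of a single vertex. -/
def Graph.Isomorphic (G G' : Graph q) : Prop :=
  ∃ φ : (G.V × Fin q) ≃ (G'.V × Fin q),
    (∀ d, φ (G.ferm d) = G'.ferm (φ d)) ∧
    (∀ d, φ (G.toPreGraph.dishat d) = G'.toPreGraph.dishat (φ d)) ∧
    ∀ v : G.V, ∃ v' : G'.V, ∀ m : Fin q, (φ (v, m)).1 = v'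

/-- `G` is melonic: isomorphic to a graph obtained from the minimal graph
`G_min` by a finite sequence of melonic moves. -/
def Graph.IsMelonic (G : Graph q) : Prop :=
  ∃ G₀ Gn : Graph q, G₀.IsMin ∧ Relation.ReflTransGen Graph.MelonicMove G₀ Gn ∧
    G.Isomorphic Gn


/-- The pre-SYK graph obtained from `H` by replacing the fermionic pairing,
keeping the vertex set and the disorder pairing. -/
def PreGraph.withFerm (H : PreGraph q) (f : Equiv.Perm (H.V × Fin q))
    (hi : ∀ d, f (f d) = d) (hf : ∀ d, f d ≠ d) : PreGraph q where
  V := H.V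
  fintypeV := H.fintypeV
  decEqV := H.decEqV
  nonemptyV := H.nonemptyV
  ferm := f
  dis := H.dis
  ferm_invol := hi
  ferm_fpf := hf
  dis_invol := H.dis_invol
  dis_fpf := H.dis_fpf

/-- `G` is the gluing `G₁^{(e₁)} ⋆ G₂^{(e₂)}` where `e₁ = {d₁, τ₁ d₁}` and
`e₂ = {d₂, τ₂ d₂}`: the vertex set is the disjoint union of those of `G₁` and
`G₂`, the disorder pairing is the union of the two disorder pairings, and the
fermionic pairing agrees with `τ₁`, `τ₂` outside `e₁ ∪ e₂` and pairs `d₁` with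
`d₂`, and `τ₁ d₁` with `τ₂ d₂`. -/
def Graph.IsStarGluing (G₁ G₂ G : Graph q) (d₁ : G₁.V × Fin q)
    (d₂ : G₂.V × Fin q) : Prop :=
  ∃ (ι₁ : G₁.V → G.V) (ι₂ : G₂.V → G.V),
    Function.Injective ι₁ ∧ Function.Injective ι₂ ∧
    (∀ v₁ v₂, ι₁ v₁ ≠ ι₂ v₂) ∧
    (∀ v : G.V, (∃ v₁, ι₁ v₁ = v) ∨ (∃ v₂, ι₂ v₂ = v)) ∧
    (∀ v, G.dis (ι₁ v) = ι₁ (G₁.dis v)) ∧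
    (∀ v, G.dis (ι₂ v) = ι₂ (G₂.dis v)) ∧
    G.ferm (dartMap ι₁ d₁) = dartMap ι₂ d₂ ∧
    G.ferm (dartMap ι₁ (G₁.ferm d₁)) = dartMap ι₂ (G₂.ferm d₂) ∧
    (∀ d, d ≠ d₁ → d ≠ G₁.ferm d₁ →
      G.ferm (dartMap ι₁ d) = dartMap ι₁ (G₁.ferm d)) ∧
    (∀ d, d ≠ d₂ → d ≠ G₂.ferm d₂ →
      G.ferm (dartMap ι₂ d) = dartMap ι₂ (G₂.ferm d))

/-- `G` is the gluing `G₁^{(e₁)} ⋆̄ G₂^{(e₂)}`: as in `IsStarGluing` but the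
fermionic pairing pairs `d₁` with `τ₂ d₂`, and `τ₁ d₁` with `d₂`. -/
def Graph.IsBarGluing (G₁ G₂ G : Graph q) (d₁ : G₁.V × Fin q)
    (d₂ : G₂.V × Fin q) : Prop :=
  ∃ (ι₁ : G₁.V → G.V) (ι₂ : G₂.V → G.V),
    Function.Injective ι₁ ∧ Function.Injective ι₂ ∧
    (∀ v₁ v₂, ι₁ v₁ ≠ ι₂ v₂) ∧
    (∀ v : G.V, (∃ v₁, ι₁ v₁ = v) ∨ (∃ v₂, ι₂ v₂ = v)) ∧
    (∀ v, G.dis (ι₁ v) = ι₁ (G₁.dis v)) ∧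
    (∀ v, G.dis (ι₂ v) = ι₂ (G₂.dis v)) ∧
    G.ferm (dartMap ι₁ d₁) = dartMap ι₂ (G₂.ferm d₂) ∧
    G.ferm (dartMap ι₁ (G₁.ferm d₁)) = dartMap ι₂ d₂ ∧
    (∀ d, d ≠ d₁ → d ≠ G₁.ferm d₁ →
      G.ferm (dartMap ι₁ d) = dartMap ι₁ (G₁.ferm d)) ∧
    (∀ d, d ≠ d₂ → d ≠ G₂.ferm d₂ →
      G.ferm (dartMap ι₂ d) = dartMap ι₂ (G₂.ferm d))

/-- `H''` is the contraction of the disorder line `{v, w}` of `H`: its vertex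
set is `V(H) ∖ {v, w}` (embedded via `ι`), its disorder pairing is the
restriction of that of `H`, and its fermionic pairing pairs `τ (v, m)` with
`τ (w, m)` for each strand `m` and agrees with `τ` on all other darts. -/
def PreGraph.IsContraction (H H'' : PreGraph q) (v w : H.V) : Prop :=
  ∃ ι : H''.V → H.V,
    Function.Injective ι ∧
    (∀ u : H.V, (∃ u'', ι u'' = u) ↔ (u ≠ v ∧ u ≠ w)) ∧
    (∀ u, ι (H''.dis u) = H.dis (ι u)) ∧
    (∀ m : Fin q, ∃ a b : H''.V × Fin q,
      dartMap ι a = H.ferm (v, m) ∧ dartMap ι b = H.ferm (w, m) ∧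
      H''.ferm a = b) ∧
    (∀ d : H''.V × Fin q,
      (∀ m : Fin q, dartMap ι d ≠ H.ferm (v, m) ∧ dartMap ι d ≠ H.ferm (w, m)) →
      dartMap ι (H''.ferm d) = H.ferm (dartMap ι d))

/-- `HL` is the closure of the side `side ⊆ V(G)` of the graph `G` cut along
the fermionic lines `e₁, e₂`: its vertex set is `{v | side v}` (embedded via
`ι`), its disorder pairing is the restriction of that of `G`, and its
fermionic pairing pairs the `side`-dart of `e₁` with the `side`-dart of `e₂`
and agrees with `τ` on all darts not in `e₁ ∪ e₂`. -/
def Graph.IsSideClose (G : Graph q) (side : G.V → Prop)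
    (e₁ e₂ : Set (G.V × Fin q)) (HL : PreGraph q) : Prop :=
  ∃ ι : HL.V → G.V,
    Function.Injective ι ∧
    (∀ v : G.V, (∃ u, ι u = v) ↔ side v) ∧
    (∀ u, ι (HL.dis u) = G.dis (ι u)) ∧
    (∃ a b : HL.V × Fin q, dartMap ι a ∈ e₁ ∧ dartMap ι b ∈ e₂ ∧
      HL.ferm a = b) ∧
    (∀ d : HL.V × Fin q, dartMap ι d ∉ e₁ ∪ e₂ →
      dartMap ι (HL.ferm d) = G.ferm (dartMap ι d))


/-- The face containing a dart. -/
def PreGraph.face (H : PreGraph q) (d : H.Dart) :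
    MulAction.orbitRel.Quotient H.faceGroup H.Dart :=
  Quotient.mk _ d

lemma PreGraph.face_ferm (H : PreGraph q) (d : H.Dart) : H.face (H.ferm d) = H.face d :=
  Quotient.sound ⟨⟨H.ferm, Subgroup.subset_closure (by simp)⟩, rfl⟩

lemma PreGraph.face_dis (H : PreGraph q) (v : H.V) (m : Fin q) :
    H.face (H.dis v, m) = H.face (v, m) :=
  Quotient.sound ⟨⟨H.dishat, Subgroup.subset_closure (by simp)⟩, rfl⟩

/-- The set of disorder lines, as unordered pairs of vertices. -/
abbrev PreGraph.DisLine (H : PreGraph q) : Type :=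
  Set.range fun v : H.V => s(v, H.dis v)

/-- The disorder line at a vertex. -/
def PreGraph.disLine (H : PreGraph q) (v : H.V) : H.DisLine :=
  ⟨s(v, H.dis v), v, rfl⟩

lemma PreGraph.disLine_surjective (H : PreGraph q) : Function.Surjective H.disLine := by
  rintro ⟨_, v, rfl⟩
  exact ⟨v, rfl⟩

lemma PreGraph.disLine_eq_iff (H : PreGraph q) {v w : H.V} :
    H.disLine v = H.disLine w ↔ v = w ∨ v = H.dis w := by
  rw [Subtype.ext_iff]
  change s(v, H.dis v) = s(w, H.dis w) ↔ _
  rw [Sym2.eq_iff]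
  constructor
  · tauto
  · rintro (rfl | rfl)
    · simp
    · simp [H.dis_invol]

lemma PreGraph.nV_eq (H : PreGraph q) : H.nV = 2 * Nat.card H.DisLine := by
  classical
  have : Fintype H.DisLine := Fintype.ofFinite _
  have hfib (p : H.DisLine) : (Finset.univ.filter fun v => H.disLine v = p).card = 2 := by
    obtain ⟨w, rfl⟩ := H.disLine_surjective p
    rw [← Finset.card_pair (H.dis_fpf w).symm]
    congr 1
    ext v
    simp [H.disLine_eq_iff]
  rw [nV, Nat.card_eq_fintype_card, Nat.card_eq_fintype_card, ← Finset.card_univ,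
    Finset.card_eq_sum_card_fiberwise (f := H.disLine) (t := Finset.univ) (by simp)]
  simp [hfib, mul_comm]

/-- The bipartite incidence graph between faces and disorder lines. -/
def PreGraph.incidence (H : PreGraph q) :
    SimpleGraph (MulAction.orbitRel.Quotient H.faceGroup H.Dart ⊕ H.DisLine) :=
  SimpleGraph.fromEdgeSet
    (Set.range fun d : H.Dart => s(Sum.inl (H.face d), Sum.inr (H.disLine d.1)))

lemma PreGraph.incidence_adj (H : PreGraph q) (d : H.Dart) :
    H.incidence.Adj (Sum.inl (H.face d)) (Sum.inr (H.disLine d.1)) := by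
  rw [incidence, SimpleGraph.fromEdgeSet_adj]
  exact ⟨⟨d, rfl⟩, by simp⟩

lemma PreGraph.Conn0.incidence_connected {H : PreGraph q} (h : H.Conn0) :
    H.incidence.Connected := by
  have hline (v w : H.V) :
      H.incidence.Reachable (Sum.inr (H.disLine v)) (Sum.inr (H.disLine w)) := by
    induction h v w with
    | refl => exact .refl _
    | @tail u u' _ hstep ih =>
      obtain ⟨m, m', -, hm⟩ := hstep
      have h₁ := H.incidence_adj (u, m)
      have h₂ := H.incidence_adj (u', m')
      rw [← hm, H.face_ferm, hm] at h₂
      exact ih.trans (h₁.symm.reachable.trans h₂.reachable)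
  obtain ⟨v₀⟩ := H.nonemptyV
  rw [SimpleGraph.connected_iff_exists_forall_reachable]
  refine ⟨Sum.inr (H.disLine v₀), ?_⟩
  rintro (f | p)
  · induction f using Quotient.inductionOn with
    | _ d => exact (hline v₀ d.1).trans (H.incidence_adj d).symm.reachable
  · obtain ⟨w, rfl⟩ := H.disLine_surjective p
    exact hline v₀ w

lemma PreGraph.card_edgeSet_incidence_le (H : PreGraph q) :
    Nat.card H.incidence.edgeSet ≤ Nat.card H.DisLine * q := by
  choose r hr using H.disLine_surjective
  let e (x : H.DisLine × Fin q) : H.incidence.edgeSet :=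
    ⟨s(Sum.inl (H.face (r x.1, x.2)), Sum.inr (H.disLine (r x.1))),
      H.incidence_adj (r x.1, x.2)⟩
  have he : Function.Surjective e := by
    rintro ⟨_, hx⟩
    rw [incidence, SimpleGraph.edgeSet_fromEdgeSet] at hx
    obtain ⟨⟨⟨v, m⟩, rfl⟩, -⟩ := hx
    refine ⟨(H.disLine v, m), Subtype.ext ?_⟩
    have hface : H.face (r (H.disLine v), m) = H.face (v, m) := by
      rcases H.disLine_eq_iff.mp (hr (H.disLine v)) with h | h
      · rw [h]
      · rw [h, H.face_dis]
    simp only [e, hface, hr]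
  simpa using Nat.card_le_card_of_surjective e he

/-- The Euler bound for the incidence graph of faces and disorder lines. -/
lemma PreGraph.Conn0.F_add_card_disLine_le {H : PreGraph q} (h : H.Conn0) :
    H.F + Nat.card H.DisLine ≤ Nat.card H.DisLine * q + 1 := by
  have : Finite (MulAction.orbitRel.Quotient H.faceGroup H.Dart) := Quotient.finite _
  calc H.F + Nat.card H.DisLine
      = Nat.card (MulAction.orbitRel.Quotient H.faceGroup H.Dart ⊕ H.DisLine) :=
        Nat.card_sum.symm
    _ ≤ Nat.card H.incidence.edgeSet + 1 :=
        h.incidence_connected.card_vert_le_card_edgeSet_add_one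
    _ ≤ _ := Nat.add_le_add_right H.card_edgeSet_incidence_le 1

/-- For every integer `q ≥ 2` and every SYK graph `G`,
`F(G) ≤ 1 + (q−1)·|V(G)|/2`, i.e. `δ(G) ≤ 1`. -/
theorem syk_delta_le_one (q : ℕ) (hq : 2 ≤ q) (G : Graph q) :
    G.toPreGraph.F ≤ 1 + (q - 1) * (G.toPreGraph.nV / 2) ∧
      G.toPreGraph.delta ≤ 1 := by
  have hle := G.conn.F_add_card_disLine_le
  rw [PreGraph.delta, G.nV_eq, Nat.mul_div_cancel_left _ two_pos]
  obtain ⟨k, rfl⟩ := Nat.exists_eq_add_of_le' (one_le_two.trans hq)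
  rw [Nat.add_sub_cancel]
  constructor
  · linarith
  · zify at hle
    push_cast
    linarith

end SYK
end

section
/- For every integer q ≥ 2, an SYK graph G is melonic if and only if every pair {e₁, e₂} of distinct fermionic lines of G that belong to a common face is a 2-cut of G. -/
namespace SYK

variable {q : ℕ}

/-- The indicator function, with values in `ZMod 2`, of the fermionic line carrying the dart `a`. -/
def PreGraph.lineInd (H : PreGraph q) (a d : H.Dart) : ZMod 2 :=
  if d = a ∨ d = H.ferm a then 1 else 0

/-- `c` is a two-colouring of the vertices, constant along disorder lines, whose colour changes
exactly along the lines of `a` and `b` (and nowhere if these two lines coincide). -/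
def PreGraph.IsCut (H : PreGraph q) (c : H.V → ZMod 2) (a b : H.Dart) : Prop :=
  (∀ v, c (H.dis v) = c v) ∧
    ∀ d : H.Dart, c d.1 + c (H.ferm d).1 = H.lineInd a d + H.lineInd b d

/-- Every two lines that are consecutive along a face are separated by a cut. -/
def PreGraph.HasLocalCuts (H : PreGraph q) : Prop :=
  ∀ a : H.Dart, ∃ c, H.IsCut c a (H.dishat a)

section Cuts

variable (H : PreGraph q)

theorem PreGraph.ferm_eq_iff {a b : H.Dart} : H.ferm a = b ↔ a = H.ferm b :=
  ⟨fun h => by rw [← h, H.ferm_invol], fun h => by rw [h, H.ferm_invol]⟩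

theorem PreGraph.lineInd_ferm_right (a d : H.Dart) :
    H.lineInd a (H.ferm d) = H.lineInd a d := by
  simp only [PreGraph.lineInd, H.ferm_eq_iff, H.ferm_invol, or_comm]

theorem PreGraph.lineInd_ferm_left (a d : H.Dart) :
    H.lineInd (H.ferm a) d = H.lineInd a d := by
  simp only [PreGraph.lineInd, H.ferm_invol, or_comm]

theorem PreGraph.lineInd_self (a : H.Dart) : H.lineInd a a = 1 := by
  simp [PreGraph.lineInd]

theorem PreGraph.lineInd_of_ne {a d : H.Dart} (h₁ : d ≠ a) (h₂ : d ≠ H.ferm a) :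
    H.lineInd a d = 0 := by
  simp [PreGraph.lineInd, h₁, h₂]

@[simp]
theorem PreGraph.dishat_apply (d : H.Dart) : H.dishat d = (H.dis d.1, d.2) := rfl

theorem PreGraph.dishat_dishat (d : H.Dart) : H.dishat (H.dishat d) = d := by
  simp [H.dis_invol]

theorem zmod_two_add_self (x : ZMod 2) : x + x = 0 := CharTwo.add_self_eq_zero x

theorem zmod_two_eq_of_add {x y : ZMod 2} (h : x + y = 0) : x = y :=
  (CharTwo.add_eq_zero).1 h

theorem zmod_two_eq_zero_or_one : ∀ x : ZMod 2, x = 0 ∨ x = 1 := by decide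

variable {H}

theorem PreGraph.isCut_zero {a b : H.Dart} (h : b = a ∨ b = H.ferm a) :
    H.IsCut (fun _ => 0) a b := by
  refine ⟨fun _ => rfl, fun d => ?_⟩
  rcases h with rfl | rfl
  · simp [zmod_two_add_self]
  · simp [zmod_two_add_self, H.lineInd_ferm_left]

theorem PreGraph.IsCut.trans {c c' : H.V → ZMod 2} {a b e : H.Dart} (h : H.IsCut c a b)
    (h' : H.IsCut c' b e) : H.IsCut (fun v => c v + c' v) a e := by
  refine ⟨fun v => by simp only [h.1, h'.1], fun d => ?_⟩
  linear_combination h.2 d + h'.2 d + zmod_two_add_self (H.lineInd b d)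

theorem PreGraph.IsCut.add_const {c : H.V → ZMod 2} {a b : H.Dart} (h : H.IsCut c a b)
    (t : ZMod 2) : H.IsCut (fun v => c v + t) a b := by
  refine ⟨fun v => by simp only [h.1], fun d => ?_⟩
  linear_combination h.2 d + zmod_two_add_self t

theorem PreGraph.IsCut.symm {c : H.V → ZMod 2} {a b : H.Dart} (h : H.IsCut c a b) :
    H.IsCut c b a :=
  ⟨h.1, fun d => by rw [h.2, add_comm]⟩

/-- A colouring that is constant along disorder lines changes colour along an even number of
fermionic lines; in particular, it changes along both or none of two given ones. -/
theorem PreGraph.crossing_parity {c : H.V → ZMod 2} (hc : ∀ v, c (H.dis v) = c v)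
    {a b : H.Dart} (hab : b ≠ a) (hab' : b ≠ H.ferm a)
    (h : ∀ d, d ≠ a → d ≠ H.ferm a → d ≠ b → d ≠ H.ferm b → c d.1 + c (H.ferm d).1 = 0) :
    c a.1 + c (H.ferm a).1 = c b.1 + c (H.ferm b).1 := by
  classical
  have h₁ : ∑ d : H.Dart, c d.1 = 0 := by
    refine Finset.sum_involution (fun d _ => H.dishat d) ?_ ?_ ?_ ?_
    · intro d _
      simp [hc, zmod_two_add_self]
    · intro d _ _ h
      exact H.dis_fpf d.1 (congrArg Prod.fst h)
    · intros; simp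
    · intro d _; exact H.dishat_dishat d
  have h₂ : ∑ d : H.Dart, c d.1 * c (H.ferm d).1 = 0 := by
    refine Finset.sum_involution (fun d _ => H.ferm d) ?_ ?_ ?_ ?_
    · intro d _
      rw [H.ferm_invol, mul_comm (c (H.ferm d).1)]
      exact zmod_two_add_self _
    · intro d _ _; exact H.ferm_fpf d
    · intros; simp
    · intro d _; exact H.ferm_invol d
  have h₃ : ∑ d : H.Dart, (c d.1 + c d.1 * c (H.ferm d).1) = 0 := by
    rw [Finset.sum_add_distrib, h₁, h₂, add_zero]
  have h₄ : ∀ d ∈ (Finset.univ : Finset H.Dart),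
      d ∉ ({a, H.ferm a, b, H.ferm b} : Finset H.Dart) →
      c d.1 + c d.1 * c (H.ferm d).1 = 0 := by
    intro d _ hd
    simp only [Finset.mem_insert, Finset.mem_singleton, not_or] at hd
    rw [← zmod_two_eq_of_add (h d hd.1 hd.2.1 hd.2.2.1 hd.2.2.2)]
    generalize c d.1 = t
    revert t
    decide
  rw [← Finset.sum_subset (Finset.subset_univ _) h₄, Finset.sum_insert, Finset.sum_insert,
    Finset.sum_insert, Finset.sum_singleton] at h₃
  · simp only [H.ferm_invol] at h₃
    generalize c a.1 = s at *
    generalize c b.1 = t at *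
    generalize c (H.ferm a).1 = s' at *
    generalize c (H.ferm b).1 = t' at *
    revert s t s' t'
    clear * -
    decide
  · simpa using (H.ferm_fpf b).symm
  · have : H.ferm a ≠ H.ferm b := fun e => hab (H.ferm.injective e).symm
    simp [this, hab'.symm]
  · have : a ≠ H.ferm b := fun e => hab' (by rw [e, H.ferm_invol])
    simp [this, hab.symm, (H.ferm_fpf a).symm]

/-- Under the hypotheses of `crossing_parity`, a colouring changing along `b` is a cut. -/
theorem PreGraph.isCut_of_crossing {c : H.V → ZMod 2} (hc : ∀ v, c (H.dis v) = c v)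
    {a b : H.Dart} (hab : b ≠ a) (hab' : b ≠ H.ferm a)
    (h : ∀ d, d ≠ a → d ≠ H.ferm a → d ≠ b → d ≠ H.ferm b → c d.1 + c (H.ferm d).1 = 0)
    (hb : c b.1 + c (H.ferm b).1 = 1) : H.IsCut c a b := by
  have ha := (H.crossing_parity hc hab hab' h).trans hb
  have hba : a ≠ H.ferm b := fun e => hab' (by rw [e, H.ferm_invol])
  refine ⟨hc, fun d => ?_⟩
  have key : ∀ e, c (H.ferm e).1 + c (H.ferm (H.ferm e)).1 = c e.1 + c (H.ferm e).1 := by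
    intro e; rw [H.ferm_invol, add_comm]
  by_cases h₁ : d = a
  · subst h₁; rw [ha, H.lineInd_self, H.lineInd_of_ne hab.symm hba, add_zero]
  by_cases h₂ : d = H.ferm a
  · subst h₂
    rw [key, ha, H.lineInd_ferm_right, H.lineInd_ferm_right, H.lineInd_self,
      H.lineInd_of_ne hab.symm hba, add_zero]
  by_cases h₃ : d = b
  · subst h₃; rw [hb, H.lineInd_self, H.lineInd_of_ne hab hab', zero_add]
  by_cases h₄ : d = H.ferm b
  · subst h₄
    rw [key, hb, H.lineInd_ferm_right, H.lineInd_ferm_right, H.lineInd_self,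
      H.lineInd_of_ne hab hab', zero_add]
  rw [h d h₁ h₂ h₃ h₄, H.lineInd_of_ne h₁ h₂, H.lineInd_of_ne h₃ h₄, add_zero]

/-- Connectivity of `G₀` in terms of two-colourings of the vertices. -/
theorem PreGraph.conn0_iff_colouring : H.Conn0 ↔
    ∀ c : H.V → ZMod 2, (∀ d : H.Dart, c d.1 = c (H.ferm d).1) → ∀ v w, c v = c w := by
  classical
  constructor
  · intro h c hc v w
    induction h v w with
    | refl => rfl
    | tail _ hs ih =>
      obtain ⟨m, m', -, hm⟩ := hs
      rw [ih, hc (_, m), hm]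
  · intro h v w
    have hadj : ∀ d : H.Dart, H.adj0 d.1 (H.ferm d).1 :=
      fun d => ⟨d.2, (H.ferm d).2, Set.notMem_empty _, rfl⟩
    have := h (fun u => if Relation.ReflTransGen H.adj0 v u then 1 else 0) (fun d => by
      have : Relation.ReflTransGen H.adj0 v d.1 ↔
          Relation.ReflTransGen H.adj0 v (H.ferm d).1 :=
        ⟨fun p => p.tail (hadj d), fun p => p.tail (by
          simpa only [H.ferm_invol] using hadj (H.ferm d))⟩
      simp only [this]) v w
    by_contra hw
    simp [Relation.ReflTransGen.refl, hw] at this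

theorem PreGraph.HasLocalCuts.exists_isCut_of_sameFace (h : H.HasLocalCuts) {a b : H.Dart}
    (hab : H.SameFace a b) : ∃ c, H.IsCut c a b := by
  obtain ⟨⟨g, hg⟩, rfl⟩ := hab
  change ∃ c, H.IsCut c (g b) b
  induction hg using Subgroup.closure_induction generalizing b with
  | mem g hg =>
    rcases hg with rfl | rfl
    · exact ⟨_, H.isCut_zero (Or.inr (H.ferm_invol b).symm)⟩
    · obtain ⟨c, hc⟩ := h b
      exact ⟨c, hc.symm⟩
  | one => exact ⟨_, H.isCut_zero (Or.inl rfl)⟩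
  | mul x y _ _ hx hy =>
    obtain ⟨c, hc⟩ := hx (b := y b)
    obtain ⟨c', hc'⟩ := hy (b := b)
    exact ⟨_, hc.trans hc'⟩
  | inv x _ hx =>
    obtain ⟨c, hc⟩ := hx (b := x⁻¹ b)
    exact ⟨c, by simpa using hc.symm⟩

theorem PreGraph.line_eq_line_iff {a b : H.Dart} :
    ({a, H.ferm a} : Set H.Dart) = {b, H.ferm b} ↔ b = a ∨ b = H.ferm a := by
  constructor
  · intro h
    have : b ∈ ({a, H.ferm a} : Set H.Dart) := h ▸ Or.inl rfl
    simpa using this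
  · rintro (rfl | rfl)
    · rfl
    · rw [H.ferm_invol, Set.pair_comm]

theorem PreGraph.IsLine.eq_of_mem {e : Set H.Dart} (he : H.IsLine e) {d : H.Dart}
    (hd : d ∈ e) : e = {d, H.ferm d} := by
  obtain ⟨a, rfl⟩ := he
  exact H.line_eq_line_iff.2 (by simpa using hd)

theorem PreGraph.IsCut.twoCutPlus {c : H.V → ZMod 2} {a b : H.Dart} (h : H.IsCut c a b)
    (hab : b ≠ a) (hab' : b ≠ H.ferm a) :
    H.TwoCutPlus {a, H.ferm a} {b, H.ferm b} := by
  intro hcon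
  have key : ∀ v w, Relation.ReflTransGen
      (H.adjPlusOff ({a, H.ferm a} ∪ {b, H.ferm b})) v w → c v = c w := by
    intro v w p
    induction p with
    | refl => rfl
    | @tail u _ _ hs ih =>
      rw [ih]
      rcases hs with ⟨m, m', hm, hf⟩ | hs
      · simp only [Set.mem_union, Set.mem_insert_iff, Set.mem_singleton_iff, not_or] at hm
        have := h.2 (u, m)
        rw [H.lineInd_of_ne hm.1.1 hm.1.2, H.lineInd_of_ne hm.2.1 hm.2.2, hf, add_zero] at this
        exact zmod_two_eq_of_add this
      · rw [← hs, h.1]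
  have := h.2 b
  rw [key _ _ (hcon b.1 (H.ferm b).1), zmod_two_add_self, H.lineInd_self,
    H.lineInd_of_ne hab hab'] at this
  simp at this

theorem PreGraph.TwoCutPlus.exists_isCut (hH : H.Conn0) {a b : H.Dart} (hab : b ≠ a)
    (hab' : b ≠ H.ferm a) (h : H.TwoCutPlus {a, H.ferm a} {b, H.ferm b}) :
    ∃ c, H.IsCut c a b := by
  classical
  simp only [PreGraph.TwoCutPlus, PreGraph.DisconnectsPlus, not_forall] at h
  obtain ⟨v, w, hvw⟩ := h
  set S : Set H.Dart := {a, H.ferm a} ∪ {b, H.ferm b} with hS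
  let R := H.adjPlusOff S
  let c : H.V → ZMod 2 := fun u => if Relation.ReflTransGen R v u then 1 else 0
  have hc : ∀ u, c (H.dis u) = c u := by
    intro u
    have : Relation.ReflTransGen R v (H.dis u) ↔ Relation.ReflTransGen R v u :=
      ⟨fun p => p.tail (Or.inr (H.dis_invol u)), fun p => p.tail (Or.inr rfl)⟩
    simp only [c, this]
  have hd : ∀ d, d ≠ a → d ≠ H.ferm a → d ≠ b → d ≠ H.ferm b →
      c d.1 + c (H.ferm d).1 = 0 := by
    intro d h₁ h₂ h₃ h₄
    have hdS : d ∉ S := by simp [hS, h₁, h₂, h₃, h₄]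
    have hdS' : H.ferm d ∉ S := by
      simp only [hS, Set.mem_union, Set.mem_insert_iff, Set.mem_singleton_iff, H.ferm_eq_iff,
        H.ferm_invol]
      tauto
    have : Relation.ReflTransGen R v d.1 ↔ Relation.ReflTransGen R v (H.ferm d).1 :=
      ⟨fun p => p.tail (Or.inl ⟨d.2, (H.ferm d).2, hdS, rfl⟩),
        fun p => p.tail (Or.inl ⟨(H.ferm d).2, d.2, hdS', H.ferm_invol d⟩)⟩
    simp only [c, this, zmod_two_add_self]
  have hpar := H.crossing_parity hc hab hab' hd
  refine ⟨c, H.isCut_of_crossing hc hab hab' hd ?_⟩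
  refine (zmod_two_eq_zero_or_one _).resolve_left fun hb => ?_
  have hconst := H.conn0_iff_colouring.1 hH c (fun d => zmod_two_eq_of_add ?_) v w
  · simp [c, Relation.ReflTransGen.refl, show ¬ Relation.ReflTransGen R v w from hvw] at hconst
  · have key : ∀ e, c (H.ferm e).1 + c (H.ferm (H.ferm e)).1 = c e.1 + c (H.ferm e).1 := by
      intro e; rw [H.ferm_invol, add_comm]
    by_cases h₁ : d = a
    · rw [h₁, hpar, hb]
    by_cases h₂ : d = H.ferm a
    · rw [h₂, key, hpar, hb]
    by_cases h₃ : d = b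
    · rw [h₃, hb]
    by_cases h₄ : d = H.ferm b
    · rw [h₄, key, hb]
    exact hd d h₁ h₂ h₃ h₄

theorem PreGraph.hasLocalCuts_iff (hH : H.Conn0) : H.HasLocalCuts ↔
    ∀ e₁ e₂ : Set H.Dart, H.IsLine e₁ → H.IsLine e₂ → e₁ ≠ e₂ →
      H.LinesShareFace e₁ e₂ → H.TwoCutPlus e₁ e₂ := by
  constructor
  · rintro h e₁ e₂ he₁ he₂ hne ⟨a, ha, b, hb, hab⟩
    obtain rfl := he₁.eq_of_mem ha
    obtain rfl := he₂.eq_of_mem hb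
    obtain ⟨c, hc⟩ := h.exists_isCut_of_sameFace hab
    rw [Ne, H.line_eq_line_iff, not_or] at hne
    exact hc.twoCutPlus hne.1 hne.2
  · intro h a
    by_cases hne : H.dishat a = a ∨ H.dishat a = H.ferm a
    · exact ⟨_, H.isCut_zero hne⟩
    · have hcut := h _ _ ⟨a, rfl⟩ ⟨H.dishat a, rfl⟩ (fun e => hne (H.line_eq_line_iff.1 e))
        ⟨a, Or.inl rfl, H.dishat a, Or.inl rfl,
          ⟨⟨H.dishat, Subgroup.subset_closure (Or.inr rfl)⟩, H.dishat_dishat a⟩⟩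
      rw [not_or] at hne
      exact hcut.exists_isCut hH hne.1 hne.2

theorem PreGraph.HasLocalCuts.exists_isCut_eq_zero (h : H.HasLocalCuts) (a : H.Dart) (v : H.V) :
    ∃ c, H.IsCut c a (H.dishat a) ∧ c v = 0 := by
  obtain ⟨c, hc⟩ := h a
  exact ⟨_, hc.add_const (c v), zmod_two_add_self _⟩

end Cuts

section Insertion

/-- `G'` is obtained from `G` by inserting two vertices `x, y` on the line of the dart `d`, as in a
melonic move, but with an arbitrary strand `m` in the role of the first one. -/
structure PreGraph.IsInsertion (G G' : PreGraph q) (x y : G'.V) (ι : G.V → G'.V) (d : G.Dart)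
    (m : Fin q) : Prop where
  inj : Function.Injective ι
  notMem_range : ∀ v', (¬ ∃ v, ι v = v') ↔ (v' = x ∨ v' = y)
  dis_new : G'.dis x = y
  dis_old : ∀ v, G'.dis (ι v) = ι (G.dis v)
  ferm_in : G'.ferm (dartMap ι d) = (x, m)
  ferm_out : G'.ferm (y, m) = dartMap ι (G.ferm d)
  ferm_new : ∀ k, k ≠ m → G'.ferm (x, k) = (y, k)
  ferm_old : ∀ d', d' ≠ d → d' ≠ G.ferm d → G'.ferm (dartMap ι d') = dartMap ι (G.ferm d')

theorem dartMap_injective {α β : Type} {ι : α → β} (h : Function.Injective ι) :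
    Function.Injective (dartMap (q := q) ι) := by
  rintro ⟨a, k⟩ ⟨b, l⟩ e
  simp only [dartMap, Prod.mk.injEq] at e
  rw [h e.1, e.2]

namespace PreGraph.IsInsertion

variable {G G' : PreGraph q} {x y : G'.V} {ι : G.V → G'.V} {d : G.Dart} {m : Fin q}

theorem ne_left (h : G.IsInsertion G' x y ι d m)
    (v : G.V) : ι v ≠ x := fun e => (h.notMem_range x).2 (Or.inl rfl) ⟨v, e⟩

theorem ne_right (h : G.IsInsertion G' x y ι d m)
    (v : G.V) : ι v ≠ y := fun e => (h.notMem_range y).2 (Or.inr rfl) ⟨v, e⟩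

theorem new_ne (h : G.IsInsertion G' x y ι d m) :
    x ≠ y := fun e => G'.dis_fpf x (h.dis_new.trans e.symm)

theorem old_or_new (h : G.IsInsertion G' x y ι d m)
    (v' : G'.V) : (∃ v, ι v = v') ∨ v' = x ∨ v' = y := by
  by_cases hv : ∃ v, ι v = v'
  · exact Or.inl hv
  · exact Or.inr ((h.notMem_range v').1 hv)

theorem dis_right (h : G.IsInsertion G' x y ι d m) :
    G'.dis y = x := by rw [← h.dis_new, G'.dis_invol]

theorem ferm_left (h : G.IsInsertion G' x y ι d m) :
    G'.ferm (x, m) = dartMap ι d := by rw [← h.ferm_in, G'.ferm_invol]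

theorem ferm_right_new (h : G.IsInsertion G' x y ι d m)
    {k : Fin q} (hk : k ≠ m) : G'.ferm (y, k) = (x, k) := by
  rw [← h.ferm_new k hk, G'.ferm_invol]

theorem ferm_in' (h : G.IsInsertion G' x y ι d m) : G'.ferm (dartMap ι (G.ferm d)) = (y, m) := by
  rw [← h.ferm_out, G'.ferm_invol]

theorem lineInd_new (h : G.IsInsertion G' x y ι d m) {a : G.Dart} {k : Fin q} (hk : k ≠ m) :
    G'.lineInd (dartMap ι a) (x, k) = 0 := by
  refine G'.lineInd_of_ne (fun e => h.ne_left a.1 (congrArg Prod.fst e).symm) (fun e => ?_)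
  rw [← G'.ferm_eq_iff, h.ferm_new k hk] at e
  exact h.ne_right a.1 (congrArg Prod.fst e).symm

theorem lineInd_old (h : G.IsInsertion G' x y ι d m)
    {a d' : G.Dart} (h₁ : d' ≠ d) (h₂ : d' ≠ G.ferm d) :
    G'.lineInd (dartMap ι a) (dartMap ι d') = G.lineInd a d' := by
  have hi := dartMap_injective (q := q) h.inj
  have e : dartMap ι d' = G'.ferm (dartMap ι a) ↔ d' = G.ferm a := by
    rw [← G'.ferm_eq_iff, h.ferm_old d' h₁ h₂, hi.eq_iff, G.ferm_eq_iff]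
  simp only [PreGraph.lineInd, e, hi.eq_iff]

theorem lineInd_line (h : G.IsInsertion G' x y ι d m) (a : G.Dart) :
    G'.lineInd (dartMap ι a) (dartMap ι d) + G'.lineInd (dartMap ι a) (dartMap ι (G.ferm d)) =
      G.lineInd a d := by
  have hi := dartMap_injective (q := q) h.inj
  have e₁ : dartMap ι d ≠ G'.ferm (dartMap ι a) := fun e => by
    rw [← G'.ferm_eq_iff, h.ferm_in] at e
    exact h.ne_left a.1 (congrArg Prod.fst e).symm
  have e₂ : dartMap ι (G.ferm d) ≠ G'.ferm (dartMap ι a) := fun e => by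
    rw [← G'.ferm_eq_iff, h.ferm_in'] at e
    exact h.ne_right a.1 (congrArg Prod.fst e).symm
  simp only [PreGraph.lineInd, e₁, e₂, hi.eq_iff, or_false, G.ferm_eq_iff]
  by_cases h₁ : d = a
  · have : d ≠ G.ferm a := fun e => G.ferm_fpf a (by rw [← e, h₁])
    simp [h₁, (G.ferm_fpf a).symm]
  · simp [h₁]

theorem dishat_old (h : G.IsInsertion G' x y ι d m)
    (a : G.Dart) : G'.dishat (dartMap ι a) = dartMap ι (G.dishat a) := by
  simp [dartMap, h.dis_old]

/-- To check a property of all lines of `G'`, it suffices to consider the old lines, the two halves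
of the subdivided line, and the lines joining the two new vertices. -/
theorem line_induction (h : G.IsInsertion G' x y ι d m)
    {P : G'.Dart → Prop} (hP : ∀ e, P (G'.ferm e) → P e)
    (h_in : P (dartMap ι d)) (h_out : P (dartMap ι (G.ferm d)))
    (h_new : ∀ k, k ≠ m → P (x, k))
    (h_old : ∀ e, e ≠ d → e ≠ G.ferm d → P (dartMap ι e)) (e : G'.Dart) : P e := by
  obtain ⟨v, k⟩ := e
  rcases h.old_or_new v with ⟨u, rfl⟩ | rfl | rfl
  · by_cases h₁ : (u, k) = d
    · rw [← h₁] at h_in; exact h_in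
    by_cases h₂ : (u, k) = G.ferm d
    · rw [← h₂] at h_out; exact h_out
    exact h_old _ h₁ h₂
  · by_cases hk : k = m
    · subst hk; exact hP _ (by rwa [h.ferm_left])
    · exact h_new k hk
  · by_cases hk : k = m
    · subst hk; exact hP _ (by rwa [h.ferm_out])
    · exact hP _ (by rw [h.ferm_right_new hk]; exact h_new k hk)

theorem isCut_restrict (h : G.IsInsertion G' x y ι d m) {c : G'.V → ZMod 2} {a b : G.Dart}
    (hc : G'.IsCut c (dartMap ι a) (dartMap ι b)) : G.IsCut (fun v => c (ι v)) a b := by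
  have hd : c (ι d.1) + c (ι (G.ferm d).1) = G.lineInd a d + G.lineInd b d := by
    have e₁ := hc.2 (dartMap ι d)
    have e₂ := hc.2 (dartMap ι (G.ferm d))
    rw [h.ferm_in] at e₁
    rw [h.ferm_in'] at e₂
    have e₃ : c x = c y := by rw [← h.dis_new, hc.1]
    simp only [dartMap] at e₁ e₂
    have e₄ := h.lineInd_line a
    have e₅ := h.lineInd_line b
    simp only [dartMap] at e₄ e₅
    linear_combination e₁ + e₂ + e₄ + e₅ + e₃ - zmod_two_add_self (c x)
  refine ⟨fun v => by simp only [← h.dis_old, hc.1], fun e => ?_⟩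
  by_cases h₁ : e = d
  · rw [h₁, hd]
  by_cases h₂ : e = G.ferm d
  · rw [h₂, G.ferm_invol, add_comm, hd, G.lineInd_ferm_right, G.lineInd_ferm_right]
  have := hc.2 (dartMap ι e)
  rw [h.ferm_old e h₁ h₂, h.lineInd_old h₁ h₂, h.lineInd_old h₁ h₂] at this
  exact this

theorem exists_isCut_extend (h : G.IsInsertion G' x y ι d m)
    {c : G.V → ZMod 2} {a b : G.Dart} (hc : G.IsCut c a b) :
    ∃ c', G'.IsCut c' (dartMap ι a) (dartMap ι b) := by
  set t := c d.1 + (G'.lineInd (dartMap ι a) (dartMap ι d) +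
    G'.lineInd (dartMap ι b) (dartMap ι d)) with ht
  set c' := Function.extend ι c (fun _ => t) with hc'
  have hι : ∀ v, c' (ι v) = c v := fun v => h.inj.extend_apply c _ v
  have hx : c' x = t := Function.extend_apply' _ _ _ ((h.notMem_range x).2 (Or.inl rfl))
  have hy : c' y = t := Function.extend_apply' _ _ _ ((h.notMem_range y).2 (Or.inr rfl))
  refine ⟨c', fun v => ?_, ?_⟩
  · rcases h.old_or_new v with ⟨u, rfl⟩ | rfl | rfl
    · rw [h.dis_old, hι, hι, hc.1]
    · rw [h.dis_new, hx, hy]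
    · rw [h.dis_right, hx, hy]
  · refine h.line_induction ?_ ?_ ?_ ?_ ?_
    · intro e he
      rwa [G'.ferm_invol, G'.lineInd_ferm_right, G'.lineInd_ferm_right, add_comm] at he
    · rw [h.ferm_in, hx, ht]
      simp only [dartMap, hι]
      linear_combination zmod_two_add_self (c d.1)
    · rw [h.ferm_in', hy, ht]
      have e₄ := h.lineInd_line a
      have e₅ := h.lineInd_line b
      have e₆ := hc.2 d
      have e₇ : c' (dartMap ι (G.ferm d)).1 = c (G.ferm d).1 := hι _
      rw [e₇]
      linear_combination e₆ - e₄ - e₅ + zmod_two_add_self (G'.lineInd (dartMap ι a) (dartMap ι d)) +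
        zmod_two_add_self (G'.lineInd (dartMap ι b) (dartMap ι d))
    · intro k hk
      rw [h.ferm_new k hk, hx, hy, h.lineInd_new hk, h.lineInd_new hk, zmod_two_add_self, add_zero]
    · intro e h₁ h₂
      rw [h.ferm_old e h₁ h₂, h.lineInd_old h₁ h₂, h.lineInd_old h₁ h₂]
      simp only [dartMap, hι]
      exact hc.2 e

theorem exists_isCut_new (h : G.IsInsertion G' x y ι d m) : ∃ c, G'.IsCut c (x, m) (y, m) := by
  classical
  set c : G'.V → ZMod 2 := fun v => if v = x ∨ v = y then 1 else 0 with hc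
  have hι : ∀ v, c (ι v) = 0 := fun v => by simp [hc, h.ne_left, h.ne_right]
  have hx : c x = 1 := by simp [hc]
  have hy : c y = 1 := by simp [hc]
  have hi := dartMap_injective (q := q) h.inj
  have hne₁ : ∀ v k n, (ι v, k) ≠ ((x, n) : G'.Dart) :=
    fun v k n e => h.ne_left v (congrArg Prod.fst e)
  have hne₂ : ∀ v k n, (ι v, k) ≠ ((y, n) : G'.Dart) :=
    fun v k n e => h.ne_right v (congrArg Prod.fst e)
  refine ⟨c, fun v => ?_, ?_⟩
  · rcases h.old_or_new v with ⟨u, rfl⟩ | rfl | rfl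
    · rw [h.dis_old, hι, hι]
    · rw [h.dis_new, hx, hy]
    · rw [h.dis_right, hx, hy]
  · refine h.line_induction ?_ ?_ ?_ ?_ ?_
    · intro e he
      rwa [G'.ferm_invol, G'.lineInd_ferm_right, G'.lineInd_ferm_right, add_comm] at he
    · rw [h.ferm_in, hx, ← h.ferm_left, G'.lineInd_ferm_right, G'.lineInd_ferm_right,
        G'.lineInd_self, G'.lineInd_of_ne (a := (y, m))]
      · rw [h.ferm_left, dartMap, hι, zero_add, add_zero]
      · simp [h.new_ne]
      · rw [h.ferm_out]; exact (hne₁ _ _ _).symm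
    · rw [h.ferm_in', hy, ← h.ferm_out, G'.lineInd_ferm_right, G'.lineInd_ferm_right,
        G'.lineInd_self, G'.lineInd_of_ne (a := (x, m))]
      · rw [h.ferm_out, dartMap, hι]
      · simp [h.new_ne.symm]
      · rw [h.ferm_left]; exact (hne₂ _ _ _).symm
    · intro k hk
      rw [h.ferm_new k hk, hx, hy, G'.lineInd_of_ne, G'.lineInd_of_ne, zmod_two_add_self, add_zero]
      · simp [hk]
      · rw [h.ferm_out]; exact (hne₁ _ _ _).symm
      · simp [hk]
      · rw [h.ferm_left]; exact (hne₁ _ _ _).symm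
    · intro e h₁ h₂
      rw [h.ferm_old e h₁ h₂, G'.lineInd_of_ne, G'.lineInd_of_ne]
      · simp [dartMap, hι]
      · exact hne₂ _ _ _
      · rw [h.ferm_out, Ne, hi.eq_iff]; exact h₂
      · exact hne₁ _ _ _
      · rw [h.ferm_left, Ne, hi.eq_iff]; exact h₁

theorem hasLocalCuts_iff (h : G.IsInsertion G' x y ι d m) : G'.HasLocalCuts ↔ G.HasLocalCuts := by
  constructor
  · intro hG a
    obtain ⟨c, hc⟩ := hG (dartMap ι a)
    rw [h.dishat_old] at hc
    exact ⟨_, h.isCut_restrict hc⟩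
  · rintro hG ⟨v, k⟩
    rcases h.old_or_new v with ⟨u, rfl⟩ | rfl | rfl
    · obtain ⟨c, hc⟩ := hG (u, k)
      have := h.exists_isCut_extend hc
      rwa [← h.dishat_old] at this
    · rw [G'.dishat_apply, h.dis_new]
      by_cases hk : k = m
      · subst hk; exact h.exists_isCut_new
      · exact ⟨_, G'.isCut_zero (Or.inr (h.ferm_new k hk).symm)⟩
    · rw [G'.dishat_apply, h.dis_right]
      by_cases hk : k = m
      · subst hk; exact h.exists_isCut_new.imp fun _ => PreGraph.IsCut.symm
      · exact ⟨_, G'.isCut_zero (Or.inr (h.ferm_right_new hk).symm)⟩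

theorem conn0_of (h : G.IsInsertion G' x y ι d m) (hG : G'.Conn0) : G.Conn0 := by
  rw [PreGraph.conn0_iff_colouring] at hG ⊢
  intro c hc
  set c' := Function.extend ι c (fun _ => c d.1) with hc'
  have hι : ∀ v, c' (ι v) = c v := fun v => h.inj.extend_apply c _ v
  have hx : c' x = c d.1 := Function.extend_apply' _ _ _ ((h.notMem_range x).2 (Or.inl rfl))
  have hy : c' y = c d.1 := Function.extend_apply' _ _ _ ((h.notMem_range y).2 (Or.inr rfl))
  have key := hG c' (by
    refine h.line_induction (fun e he => by rw [he, G'.ferm_invol]) ?_ ?_ ?_ ?_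
    · rw [h.ferm_in, hx]; exact hι _
    · rw [h.ferm_in', hy, hc d]; exact hι _
    · intro k hk
      rw [h.ferm_new k hk, hx, hy]
    · intro e h₁ h₂
      rw [h.ferm_old e h₁ h₂]
      simp only [dartMap, hι, hc e])
  intro v w
  rw [← hι v, ← hι w, key (ι v)]

theorem conn0 (h : G.IsInsertion G' x y ι d m) (hq : 2 ≤ q) (hG : G.Conn0) : G'.Conn0 := by
  rw [PreGraph.conn0_iff_colouring] at hG ⊢
  intro c hc
  have hin : c (ι d.1) = c x := by
    have := hc (dartMap ι d)
    rwa [h.ferm_in] at this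
  have hout : c (ι (G.ferm d).1) = c y := by
    have := hc (dartMap ι (G.ferm d))
    rwa [h.ferm_in'] at this
  have hxy : c x = c y := by
    have : Nontrivial (Fin q) := Fin.nontrivial_iff_two_le.2 hq
    obtain ⟨k, hk⟩ := exists_ne m
    simpa only [h.ferm_new k hk] using hc (x, k)
  have key := hG (fun v => c (ι v)) (fun e => by
    by_cases h₁ : e = d
    · rw [h₁, hin, hxy, hout]
    by_cases h₂ : e = G.ferm d
    · rw [h₂, G.ferm_invol, hin, hxy, hout]
    have := hc (dartMap ι e)
    rwa [h.ferm_old e h₁ h₂] at this)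
  have hconst : ∀ v, c v = c x := by
    intro v
    rcases h.old_or_new v with ⟨u, rfl⟩ | rfl | rfl
    · rw [← hin, key u]
    · rfl
    · exact hxy.symm
  intro v w
  rw [hconst v, hconst w]

theorem card_lt (h : G.IsInsertion G' x y ι d m) : Fintype.card G.V < Fintype.card G'.V :=
  Fintype.card_lt_of_injective_not_surjective ι h.inj fun hs => by
    obtain ⟨v, hv⟩ := hs x
    exact h.ne_left v hv

end PreGraph.IsInsertion

theorem Graph.MelonicMove.hasLocalCuts {G G' : Graph q} (h : G.MelonicMove G')
    (hG : G.toPreGraph.HasLocalCuts) : G'.toPreGraph.HasLocalCuts := by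
  obtain ⟨x, y, ι, d, h₁, -, h₃, h₄, h₅, h₆, h₇, h₈, h₉⟩ := h
  exact (PreGraph.IsInsertion.hasLocalCuts_iff (G := G.toPreGraph)
    ⟨h₁, h₃, h₄, h₅, h₆, h₇, h₈, h₉⟩).2 hG

theorem Graph.IsMin.hasLocalCuts {G : Graph q} (h : G.IsMin) : G.toPreGraph.HasLocalCuts := by
  obtain ⟨a, b, -, hv, hab, hf⟩ := h
  rintro ⟨v, k⟩
  refine ⟨_, PreGraph.isCut_zero (Or.inr ?_)⟩
  rcases hv v with rfl | rfl
  · rw [hf, PreGraph.dishat_apply, hab]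
  · rw [← hf, PreGraph.dishat_apply, hf, G.ferm_eq_iff.2 (hf k).symm]
    rw [← hab, G.dis_invol]

theorem Graph.Isomorphic.hasLocalCuts {G G' : Graph q} (h : G.Isomorphic G')
    (hG' : G'.toPreGraph.HasLocalCuts) : G.toPreGraph.HasLocalCuts := by
  obtain ⟨φ, hf, hd, hv⟩ := h
  choose f hfv using hv
  intro a
  obtain ⟨c, hc⟩ := hG' (φ a)
  have hind : ∀ b e, G'.toPreGraph.lineInd (φ b) (φ e) = G.toPreGraph.lineInd b e := by
    intro b e
    simp only [PreGraph.lineInd, ← hf, φ.injective.eq_iff]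
  refine ⟨fun v => c (f v), fun v => ?_, fun e => ?_⟩
  · have := hd (v, a.2)
    simp only [PreGraph.dishat_apply] at this
    change c (f _) = c (f v)
    rw [← hfv _ a.2, this, hc.1, hfv]
  · change c (f _) + c (f _) = _
    rw [← hfv _ e.2, ← hfv (G.ferm e).1 (G.ferm e).2, Prod.mk.eta, Prod.mk.eta, hf, hc.2, ← hd,
      hind, hind]

theorem Graph.IsMelonic.hasLocalCuts {G : Graph q} (h : G.IsMelonic) :
    G.toPreGraph.HasLocalCuts := by
  obtain ⟨G₀, Gn, h₀, hm, hi⟩ := h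
  refine hi.hasLocalCuts ?_
  clear hi
  induction hm with
  | refl => exact h₀.hasLocalCuts
  | tail _ hs ih => exact hs.hasLocalCuts ih

end Insertion

section Melons

/-- A colouring cutting the graph along two distinct lines, with as few vertices of colour `1` as
possible, isolates the two ends of a disorder line joined by all but one of their strands. -/
theorem PreGraph.HasLocalCuts.exists_melon {H : PreGraph q} (h : H.HasLocalCuts)
    (hne : ∃ a, H.dishat a ≠ H.ferm a) :
    ∃ a : H.Dart, H.ferm a ≠ H.dishat a ∧
      ∀ k, k ≠ a.2 → H.ferm (a.1, k) = (H.dis a.1, k) := by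
  classical
  have hfpf : ∀ a, H.dishat a ≠ a := fun a e => H.dis_fpf a.1 (congrArg Prod.fst e)
  let P : ℕ → Prop := fun n => ∃ (c : H.V → ZMod 2) (a b : H.Dart), H.IsCut c a b ∧ b ≠ a ∧
    b ≠ H.ferm a ∧ (Finset.univ.filter fun v => c v = 1).card = n
  have hP : ∃ n, P n := by
    obtain ⟨a, ha⟩ := hne
    obtain ⟨c, hc⟩ := h a
    exact ⟨_, c, a, _, hc, hfpf a, ha, rfl⟩
  obtain ⟨c, a₀, b₀, hc₀, hab₀, hab₀', hcard⟩ := Nat.find_spec hP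
  have hmin : ∀ (c' : H.V → ZMod 2) (a b : H.Dart) (v : H.V),
      H.IsCut (fun v => c v * c' v) a b → b ≠ a → b ≠ H.ferm a → c v = 1 → c' v = 0 → False := by
    intro c' a b v hcut hba hba' hv hv'
    refine Nat.find_min hP (m := _) ?_ ⟨_, a, b, hcut, hba, hba', rfl⟩
    rw [← hcard]
    refine Finset.card_lt_card ((Finset.ssubset_iff_of_subset ?_).2 ⟨v, ?_, ?_⟩)
    · intro u hu
      simp only [Finset.mem_filter, Finset.mem_univ, true_and] at hu ⊢
      exact (zmod_two_eq_zero_or_one (c u)).resolve_left fun e => by simp [e] at hu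
    · simpa using hv
    · simp [hv']
  have orient : ∀ a : H.Dart, c a.1 + c (H.ferm a).1 = 1 →
      ∃ a', (a' = a ∨ a' = H.ferm a) ∧ c a'.1 = 1 ∧ c (H.ferm a').1 = 0 := by
    intro a ha
    rcases zmod_two_eq_zero_or_one (c a.1) with e | e
    · exact ⟨H.ferm a, Or.inr rfl, by rw [e, zero_add] at ha; exact ha, by rwa [H.ferm_invol]⟩
    · exact ⟨a, Or.inl rfl, e, by rw [e] at ha; simpa using ha⟩
  obtain ⟨a, ha₀, ha, ha'⟩ := orient a₀ (by
    rw [hc₀.2, H.lineInd_self, H.lineInd_of_ne hab₀.symm, add_zero]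
    rwa [Ne, ← H.ferm_eq_iff, eq_comm])
  obtain ⟨b, hb₀, hb, hb'⟩ := orient b₀ (by
    rw [hc₀.2, H.lineInd_self, H.lineInd_of_ne hab₀ hab₀', zero_add])
  have hca : ∀ d, H.lineInd a₀ d = H.lineInd a d := by
    intro d; rcases ha₀ with rfl | rfl
    · rfl
    · rw [H.lineInd_ferm_left]
  have hcb : ∀ d, H.lineInd b₀ d = H.lineInd b d := by
    intro d; rcases hb₀ with rfl | rfl
    · rfl
    · rw [H.lineInd_ferm_left]
  have hc : ∀ d, d ≠ a → d ≠ H.ferm a → d ≠ b → d ≠ H.ferm b → c d.1 + c (H.ferm d).1 = 0 := by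
    intro d h₁ h₂ h₃ h₄
    rw [hc₀.2, hca, hcb, H.lineInd_of_ne h₁ h₂, H.lineInd_of_ne h₃ h₄, add_zero]
  have hinside : ∀ d, c d.1 = 1 → d ≠ H.ferm a ∧ d ≠ H.ferm b := by
    intro d hd
    constructor <;> rintro rfl <;> simp_all
  have hstay : ∀ d, c d.1 = 1 → d ≠ a → d ≠ b → c (H.ferm d).1 = 1 := by
    intro d hd h₁ h₂
    rw [← zmod_two_eq_of_add (hc d h₁ (hinside d hd).1 h₂ (hinside d hd).2), hd]
  have hdis : ∀ d : H.Dart, c (H.dishat d).1 = c d.1 := fun d => hc₀.1 d.1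
  have hprod : ∀ (c' : H.V → ZMod 2) (g : H.Dart), H.IsCut c' g (H.dishat g) →
      H.dishat g ≠ H.ferm g → c g.1 = 1 → H.dishat g ≠ a → H.dishat g ≠ b →
      (∀ d, d ≠ g → d ≠ H.ferm g → d ≠ H.dishat g → d ≠ H.ferm (H.dishat g) →
        c' d.1 = 0 ∨ c d.1 + c (H.ferm d).1 = 0) →
      H.IsCut (fun v => c v * c' v) g (H.dishat g) := by
    intro c' g hc' hg hgc hga hgb hz
    refine H.isCut_of_crossing (fun v => by simp only [hc₀.1, hc'.1]) (hfpf g) hg ?_ ?_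
    · intro d h₁ h₂ h₃ h₄
      have hd := hc'.2 d
      rw [H.lineInd_of_ne h₁ h₂, H.lineInd_of_ne h₃ h₄, add_zero] at hd
      rw [← zmod_two_eq_of_add hd, ← add_mul]
      rcases hz d h₁ h₂ h₃ h₄ with e | e <;> simp [e]
    · have hd := hc'.2 (H.dishat g)
      rw [H.lineInd_of_ne (hfpf g) hg, H.lineInd_self, zero_add] at hd
      have hgc' := (hdis g).trans hgc
      simp only [hgc', hstay _ hgc' hga hgb, one_mul, hd]
  have hab : b = H.dishat a := by
    by_contra hne'
    have hf : c (H.dishat a).1 = 1 := (hdis a).trans ha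
    obtain ⟨c', hc', hbc₀⟩ := h.exists_isCut_eq_zero a b.1
    have hb₁ : b ≠ a := by
      rintro rfl
      rcases ha₀ with rfl | rfl <;> rcases hb₀ with e | e
      · exact hab₀ e.symm
      · exact hab₀' (by rw [e, H.ferm_invol])
      · exact hab₀' e.symm
      · exact hab₀ (H.ferm.injective e).symm
    have hb₂ := (hinside b hb).1
    have hb₄ : b ≠ H.ferm (H.dishat a) := fun e =>
      (hinside _ hf).2 (by rw [e, H.ferm_invol])
    have hbc := hc'.2 b
    rw [H.lineInd_of_ne hb₁ hb₂, H.lineInd_of_ne hne' hb₄, add_zero] at hbc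
    refine hmin _ a (H.dishat a) b.1 (hprod _ a hc' (hinside _ hf).1 ha (hfpf a) (Ne.symm hne') ?_)
      (hfpf a) (hinside _ hf).1 hb hbc₀
    intro d h₁ h₂ h₃ h₄
    by_cases h₅ : d = b
    · left; rw [h₅]; exact hbc₀
    by_cases h₆ : d = H.ferm b
    · left; rw [h₆, ← zmod_two_eq_of_add hbc]; exact hbc₀
    exact Or.inr (hc d h₁ h₂ h₅ h₆)
  subst hab
  refine ⟨a, ((hinside _ hb).1).symm, fun k hk => ?_⟩
  by_contra hg
  obtain ⟨c', hc', hz₀⟩ := h.exists_isCut_eq_zero (a.1, k) a.1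
  set g : H.Dart := (a.1, k) with hg_def
  have hgc : c g.1 = 1 := ha
  have hgc' : c (H.dishat g).1 = 1 := (hdis g).trans hgc
  have hg' : H.dishat g ≠ H.ferm g := fun e => hg (by rw [← e]; rfl)
  have hga : g ≠ a := fun e => hk (congrArg Prod.snd e)
  have hgb : g ≠ H.dishat a := fun e => hk (congrArg Prod.snd e)
  have hga' : H.dishat g ≠ a := fun e => hk (congrArg Prod.snd e)
  have hgb' : H.dishat g ≠ H.dishat a := fun e => hk (congrArg Prod.snd e)
  have hz₁ : c' (H.dishat a).1 = 0 := (hc'.1 a.1).trans hz₀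
  have hswap : ∀ d e, c d.1 = 1 → d ≠ H.ferm e → e ≠ H.ferm d :=
    fun d e _ h' h'' => h' (by rw [h'', H.ferm_invol])
  have hza := hc'.2 a
  rw [H.lineInd_of_ne hga.symm (hswap g a hgc (hinside g hgc).1), H.lineInd_of_ne hga'.symm
    (hswap _ a hgc' (hinside _ hgc').1), add_zero] at hza
  have hzb := hc'.2 (H.dishat a)
  rw [H.lineInd_of_ne hgb.symm (hswap g _ hgc (hinside g hgc).2), H.lineInd_of_ne hgb'.symm
    (hswap _ _ hgc' (hinside _ hgc').2), add_zero] at hzb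
  refine hmin _ g (H.dishat g) a.1 (hprod _ g hc' hg' hgc hga' hgb' ?_) (hfpf g) hg' ha hz₀
  intro d _ _ _ _
  by_cases h₁ : d = a
  · left; rw [h₁]; exact hz₀
  by_cases h₂ : d = H.ferm a
  · left; rw [h₂, ← zmod_two_eq_of_add hza]; exact hz₀
  by_cases h₃ : d = H.dishat a
  · left; rw [h₃]; exact hz₁
  by_cases h₄ : d = H.ferm (H.dishat a)
  · left; rw [h₄, ← zmod_two_eq_of_add hzb]; exact hz₁
  exact Or.inr (hc d h₁ h₂ h₃ h₄)

/-- A disorder line joined by all strands but one can be removed. -/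
theorem Graph.exists_isInsertion_of_melon (G : Graph q) (a : G.toPreGraph.Dart)
    (ha : G.ferm a ≠ G.toPreGraph.dishat a)
    (hk : ∀ k, k ≠ a.2 → G.ferm (a.1, k) = (G.dis a.1, k)) :
    ∃ (G' : Graph q) (x y : G.V) (ι : G'.V → G.V) (d : G'.V × Fin q) (m : Fin q),
      G'.toPreGraph.IsInsertion G.toPreGraph x y ι d m := by
  classical
  obtain ⟨x, m⟩ := a
  simp only [PreGraph.dishat_apply] at ha hk
  set y := G.dis x with hy
  have hyx : y ≠ x := G.dis_fpf x
  have hk' : ∀ k, k ≠ m → G.ferm (y, k) = (x, k) := fun k h => by rw [← hk k h, G.ferm_invol]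
  let good : G.V → Prop := fun v => v ≠ x ∧ v ≠ y
  have hgood : ∀ d : G.V × Fin q, G.ferm d ≠ (x, m) → G.ferm d ≠ (y, m) → good d.1 →
      good (G.ferm d).1 := by
    rintro d h₁ h₂ hd
    generalize hfd : G.ferm d = f at *
    obtain ⟨w, k⟩ := f
    rw [G.ferm_eq_iff] at hfd
    constructor
    · rintro rfl
      by_cases h : k = m
      · exact h₁ (by rw [h])
      · rw [hk k h] at hfd; exact hd.2 (by rw [hfd])
    · rintro rfl
      by_cases h : k = m
      · exact h₂ (by rw [h])
      · rw [hk' k h] at hfd; exact hd.1 (by rw [hfd])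
  have hends : ∀ v w, (v = x ∧ w = y) ∨ (v = y ∧ w = x) → good (G.ferm (v, m)).1 := by
    intro v w hvw
    generalize hfd : G.ferm (v, m) = f at *
    obtain ⟨u, k⟩ := f
    have hne : u ≠ v := by
      rintro rfl
      by_cases h : k = m
      · exact G.ferm_fpf _ (h ▸ hfd)
      · rw [G.ferm_eq_iff] at hfd
        rcases hvw with ⟨rfl, -⟩ | ⟨rfl, -⟩
        · rw [hk k h] at hfd; exact hyx (congrArg Prod.fst hfd).symm
        · rw [hk' k h] at hfd; exact hyx (congrArg Prod.fst hfd)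
    have hne' : u ≠ w := by
      rintro rfl
      by_cases h : k = m
      · subst h
        rcases hvw with ⟨rfl, rfl⟩ | ⟨rfl, rfl⟩
        · exact ha hfd
        · exact ha (G.ferm_eq_iff.2 hfd.symm)
      · rw [G.ferm_eq_iff] at hfd
        rcases hvw with ⟨rfl, rfl⟩ | ⟨rfl, rfl⟩
        · rw [hk' k h] at hfd; exact h (congrArg Prod.snd hfd).symm
        · rw [hk k h] at hfd; exact h (congrArg Prod.snd hfd).symm
    rcases hvw with ⟨rfl, rfl⟩ | ⟨rfl, rfl⟩
    exacts [⟨hne, hne'⟩, ⟨hne', hne⟩]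
  have hgx := hends x y (Or.inl ⟨rfl, rfl⟩)
  have hgy := hends y x (Or.inr ⟨rfl, rfl⟩)
  let g : G.V × Fin q → G.V × Fin q := fun d =>
    if G.ferm d = (x, m) then G.ferm (y, m) else
      if G.ferm d = (y, m) then G.ferm (x, m) else G.ferm d
  have hxy : ((y, m) : G.V × Fin q) ≠ (x, m) := fun e => hyx (congrArg Prod.fst e)
  have hg₁ : g (G.ferm (x, m)) = G.ferm (y, m) := by simp [g, G.ferm_invol]
  have hg₂ : g (G.ferm (y, m)) = G.ferm (x, m) := by simp [g, G.ferm_invol, hyx]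
  have hg₃ : ∀ d, d ≠ G.ferm (x, m) → d ≠ G.ferm (y, m) → g d = G.ferm d := by
    intro d h₁ h₂
    simp only [g, G.ferm_eq_iff, h₁, h₂, if_false]
  have hgg : ∀ d, good d.1 → good (g d).1 ∧ g (g d) = d ∧ g d ≠ d := by
    intro d hd
    by_cases h₁ : d = G.ferm (x, m)
    · subst h₁
      rw [hg₁, hg₂]
      exact ⟨hgy, rfl, fun e => hxy (G.ferm.injective e)⟩
    by_cases h₂ : d = G.ferm (y, m)
    · subst h₂
      rw [hg₂, hg₁]
      exact ⟨hgx, rfl, fun e => hxy (G.ferm.injective e).symm⟩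
    have h₃ : G.ferm d ≠ G.ferm (x, m) := fun e => hd.1 (by rw [G.ferm.injective e])
    have h₄ : G.ferm d ≠ G.ferm (y, m) := fun e => hd.2 (by rw [G.ferm.injective e])
    rw [hg₃ d h₁ h₂, hg₃ _ h₃ h₄]
    exact ⟨hgood d (fun e => h₁ (G.ferm_eq_iff.1 e)) (fun e => h₂ (G.ferm_eq_iff.1 e)) hd,
      G.ferm_invol d, G.ferm_fpf d⟩
  have hdis : ∀ v, good v → good (G.dis v) := by
    rintro v ⟨h₁, h₂⟩
    exact ⟨fun e => h₂ (by rw [hy, ← e, G.dis_invol]), fun e => h₁ (G.dis.injective e)⟩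
  let f : {v // good v} × Fin q → {v // good v} × Fin q := fun d =>
    (⟨(g (d.1.1, d.2)).1, (hgg _ d.1.2).1⟩, (g (d.1.1, d.2)).2)
  have hval : ∀ d e : {v // good v} × Fin q,
      dartMap Subtype.val d = dartMap Subtype.val e → d = e :=
    fun d e h => dartMap_injective Subtype.val_injective h
  have hfg : ∀ d, dartMap Subtype.val (f d) = g (dartMap Subtype.val d) := fun d => rfl
  have hf : Function.Involutive f := fun d => hval _ _ (by
    rw [hfg, hfg]; exact (hgg (dartMap Subtype.val d) d.1.2).2.1)
  let p : {v // good v} → {v // good v} := fun v => ⟨G.dis v.1, hdis _ v.2⟩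
  have hp : Function.Involutive p := fun v => Subtype.ext (G.dis_invol v.1)
  let H : PreGraph q :=
    { V := {v // good v}
      nonemptyV := ⟨⟨_, hgx⟩⟩
      ferm := hf.toPerm
      dis := hp.toPerm
      ferm_invol := hf
      ferm_fpf := fun d e => (hgg (dartMap Subtype.val d) d.1.2).2.2 (by
        rw [← hfg]; exact congrArg _ e)
      dis_invol := hp
      dis_fpf := fun v e => G.dis_fpf v.1 (congrArg Subtype.val e) }
  let d : H.V × Fin q := (⟨_, hgx⟩, (G.ferm (x, m)).2)
  have hd : dartMap Subtype.val d = G.ferm (x, m) := rfl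
  have hd' : dartMap Subtype.val (H.ferm d) = G.ferm (y, m) := (hfg d).trans hg₁
  have hins : H.IsInsertion G.toPreGraph x y Subtype.val d m :=
    { inj := Subtype.val_injective
      notMem_range := fun v => by
        rw [Subtype.exists]
        simp only [good]
        simp only [exists_prop, exists_eq_right]
        tauto
      dis_new := rfl
      dis_old := fun v => rfl
      ferm_in := by rw [hd, G.ferm_invol]
      ferm_out := hd'.symm
      ferm_new := hk
      ferm_old := fun e h₁ h₂ => by
        refine ((hfg e).trans (hg₃ _ ?_ ?_)).symm
        · rw [← hd]; exact fun h => h₁ (hval _ _ h)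
        · rw [← hd']; exact fun h => h₂ (hval _ _ h) }
  exact ⟨⟨H, hins.conn0_of G.conn⟩, x, y, Subtype.val, d, m, hins⟩

/-- The fermionic pairing of the graph obtained by a melonic move on the line of `e`. -/
def PreGraph.insertFerm (H : PreGraph q) (e : H.Dart) :
    (H.V ⊕ Bool) × Fin q → (H.V ⊕ Bool) × Fin q
  | (Sum.inl v, k) =>
    if (v, k) = e then (Sum.inr false, ⟨0, e.2.pos⟩) else
      if (v, k) = H.ferm e then (Sum.inr true, ⟨0, e.2.pos⟩) else dartMap Sum.inl (H.ferm (v, k))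
  | (Sum.inr b, k) =>
    if k = ⟨0, e.2.pos⟩ then dartMap Sum.inl (bif b then H.ferm e else e) else (Sum.inr !b, k)

theorem PreGraph.insertFerm_involutive (H : PreGraph q) (e : H.Dart) :
    Function.Involutive (H.insertFerm e) := by
  rintro ⟨v | b, k⟩
  · by_cases h₁ : (v, k) = e
    · subst h₁; simp [PreGraph.insertFerm, dartMap]
    by_cases h₂ : (v, k) = H.ferm e
    · simp only [PreGraph.insertFerm, h₂, if_true]
      rw [← h₂]
      simp [h₁, dartMap]
    have h₃ : H.ferm (v, k) ≠ e := fun h => h₂ (H.ferm_eq_iff.1 h)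
    have h₄ : H.ferm (v, k) ≠ H.ferm e := fun h => h₁ (H.ferm.injective h)
    simp [PreGraph.insertFerm, h₁, h₂, h₃, h₄, dartMap, H.ferm_invol]
  · by_cases hk : k = ⟨0, e.2.pos⟩
    · have := H.ferm_fpf e
      cases b <;> simp [PreGraph.insertFerm, hk, dartMap, this]
    · simp [PreGraph.insertFerm, hk]

theorem PreGraph.insertFerm_ne (H : PreGraph q) (e d) : H.insertFerm e d ≠ d := by
  obtain ⟨v | b, k⟩ := d
  · have := H.ferm_fpf (v, k)
    simp only [PreGraph.insertFerm]
    split_ifs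
    · simp
    · simp
    · simpa [dartMap, Prod.ext_iff] using this
  · simp only [PreGraph.insertFerm]
    split_ifs
    · simp [dartMap]
    · simp

/-- The result of a melonic move on the line of `e`. -/
def PreGraph.insertMelon (H : PreGraph q) (e : H.Dart) : PreGraph q where
  V := H.V ⊕ Bool
  ferm := (H.insertFerm_involutive e).toPerm
  dis := Equiv.sumCongr H.dis Equiv.boolNot
  ferm_invol := H.insertFerm_involutive e
  ferm_fpf := H.insertFerm_ne e
  dis_invol := by rintro (v | b) <;> simp [H.dis_invol]
  dis_fpf := by rintro (v | b) <;> simp [H.dis_fpf]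

theorem PreGraph.insertMelon_ferm (H : PreGraph q) (e : H.Dart) (d : (H.V ⊕ Bool) × Fin q) :
    (H.insertMelon e).ferm d = H.insertFerm e d := rfl

theorem PreGraph.isInsertion_insertMelon (H : PreGraph q) (e : H.Dart) :
    H.IsInsertion (H.insertMelon e) (Sum.inr false) (Sum.inr true) Sum.inl e ⟨0, e.2.pos⟩ where
  inj := Sum.inl_injective
  notMem_range := by rintro (v | (_ | _)) <;> simp [PreGraph.insertMelon]
  dis_new := rfl
  dis_old _ := rfl
  ferm_in := by
    refine (H.insertMelon_ferm e _).trans ?_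
    simp [PreGraph.insertFerm, dartMap]
    rfl
  ferm_out := by
    refine (H.insertMelon_ferm e _).trans ?_
    simp [PreGraph.insertFerm]
    rfl
  ferm_new k hk := by
    refine (H.insertMelon_ferm e _).trans ?_
    simp [PreGraph.insertFerm, hk]
    rfl
  ferm_old d h₁ h₂ := by
    refine (H.insertMelon_ferm e _).trans ?_
    simp [PreGraph.insertFerm, dartMap, h₁, h₂]
    rfl

theorem Graph.exists_melonicMove (hq : 2 ≤ q) (G : Graph q) (e : G.V × Fin q) :
    ∃ (G' : Graph q) (x y : G'.V) (ι : G.V → G'.V), G.MelonicMove G' ∧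
      G.toPreGraph.IsInsertion G'.toPreGraph x y ι e ⟨0, e.2.pos⟩ := by
  have h := G.toPreGraph.isInsertion_insertMelon e
  exact ⟨⟨_, h.conn0 hq G.conn⟩, _, _, _, ⟨_, _, _, e, h.inj, h.new_ne, h.notMem_range, h.dis_new,
    h.dis_old, h.ferm_in, h.ferm_out, h.ferm_new, h.ferm_old⟩, h⟩

/-- The darts of an insertion: those of the old graph, and those of the two new vertices. -/
noncomputable def PreGraph.IsInsertion.dartEquiv {G G' : PreGraph q} {x y : G'.V} {ι : G.V → G'.V}
    {d : G.Dart} {m : Fin q} (h : G.IsInsertion G' x y ι d m) :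
    G.Dart ⊕ Bool × Fin q ≃ G'.Dart :=
  Equiv.ofBijective (Sum.elim (dartMap ι) fun b => (bif b.1 then y else x, b.2)) (by
    constructor
    · refine (dartMap_injective h.inj).sumElim ?_ ?_
      · rintro ⟨_ | _, k⟩ ⟨_ | _, l⟩ <;> simp [h.new_ne, h.new_ne.symm]
      · rintro ⟨v, k⟩ ⟨_ | _, l⟩ <;> simp [dartMap, h.ne_left, h.ne_right]
    · rintro ⟨v, k⟩
      rcases h.old_or_new v with ⟨u, rfl⟩ | rfl | rfl
      · exact ⟨Sum.inl (u, k), rfl⟩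
      · exact ⟨Sum.inr (false, k), rfl⟩
      · exact ⟨Sum.inr (true, k), rfl⟩)

theorem PreGraph.IsInsertion.isomorphic {G H G' H' : Graph q} {x y : G'.V} {ι : G.V → G'.V}
    {d : G.V × Fin q} {m : Fin q}
    (h : G.toPreGraph.IsInsertion G'.toPreGraph x y ι d m) {x' y' : H'.V} {ι' : H.V → H'.V}
    {m' : Fin q} (φ : (G.V × Fin q) ≃ (H.V × Fin q))
    (hφ : ∀ d, φ (G.ferm d) = H.ferm (φ d))
    (hφ' : ∀ d, φ (G.toPreGraph.dishat d) = H.toPreGraph.dishat (φ d))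
    (hφv : ∀ v : G.V, ∃ v' : H.V, ∀ m : Fin q, (φ (v, m)).1 = v')
    (h' : H.toPreGraph.IsInsertion H'.toPreGraph x' y' ι' (φ d) m') : G'.Isomorphic H' := by
  let Φ : (G'.V × Fin q) ≃ (H'.V × Fin q) := h.dartEquiv.symm.trans
    ((Equiv.sumCongr φ (Equiv.prodCongr (Equiv.refl Bool) (Equiv.swap m m'))).trans h'.dartEquiv)
  have hold : ∀ e, Φ (dartMap ι e) = dartMap ι' (φ e) := by
    intro e
    have : h.dartEquiv.symm (dartMap ι e) = Sum.inl e := h.dartEquiv.symm_apply_eq.2 rfl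
    simp only [Φ, Equiv.trans_apply, this]
    rfl
  have hx : ∀ k, Φ (x, k) = (x', Equiv.swap m m' k) := by
    intro k
    have : h.dartEquiv.symm (x, k) = Sum.inr (false, k) := h.dartEquiv.symm_apply_eq.2 rfl
    simp only [Φ, Equiv.trans_apply, this]
    rfl
  have hy : ∀ k, Φ (y, k) = (y', Equiv.swap m m' k) := by
    intro k
    have : h.dartEquiv.symm (y, k) = Sum.inr (true, k) := h.dartEquiv.symm_apply_eq.2 rfl
    simp only [Φ, Equiv.trans_apply, this]
    rfl
  refine ⟨Φ, ?_, ?_, ?_⟩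
  · refine h.line_induction ?_ ?_ ?_ ?_ ?_
    · intro e he
      rw [G'.ferm_invol] at he
      rw [he, H'.ferm_invol]
    · rw [h.ferm_in, hx, hold, h'.ferm_in, Equiv.swap_apply_left]
    · rw [h.ferm_in', hy, hold, hφ, h'.ferm_in', Equiv.swap_apply_left]
    · intro k hk
      rw [h.ferm_new k hk, hx, hy, h'.ferm_new]
      rwa [Ne, Equiv.swap_apply_eq_iff, Equiv.swap_apply_right]
    · intro e h₁ h₂
      rw [h.ferm_old e h₁ h₂, hold, hold, h'.ferm_old, hφ]
      · exact fun e' => h₁ (φ.injective e')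
      · rw [← hφ]; exact fun e' => h₂ (φ.injective e')
  · rintro ⟨v, k⟩
    rcases h.old_or_new v with ⟨u, rfl⟩ | rfl | rfl
    · have := hold (u, k)
      simp only [dartMap] at this
      rw [this]
      have h₁ := h.dishat_old (u, k)
      have h₂ := h'.dishat_old (φ (u, k))
      simp only [dartMap] at h₁ h₂
      rw [h₁, h₂, ← hφ']
      exact hold _
    · rw [hx, PreGraph.dishat_apply, PreGraph.dishat_apply, h.dis_new, h'.dis_new, hy]
    · rw [hy, PreGraph.dishat_apply, PreGraph.dishat_apply, h.dis_right, h'.dis_right, hx]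
  · intro v
    rcases h.old_or_new v with ⟨u, rfl⟩ | rfl | rfl
    · obtain ⟨w, hw⟩ := hφv u
      exact ⟨ι' w, fun k => by rw [← hw k]; exact congrArg Prod.fst (hold (u, k))⟩
    · exact ⟨x', fun k => by rw [hx]⟩
    · exact ⟨y', fun k => by rw [hy]⟩

theorem PreGraph.IsInsertion.isMelonic (hq : 2 ≤ q) {G G' : Graph q} {x y : G'.V}
    {ι : G.V → G'.V} {d : G.V × Fin q} {m : Fin q}
    (h : G.toPreGraph.IsInsertion G'.toPreGraph x y ι d m) (hG : G.IsMelonic) :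
    G'.IsMelonic := by
  obtain ⟨G₀, Gn, h₀, hm, φ, hφ, hφ', hφv⟩ := hG
  obtain ⟨H, _, _, _, hmove, hins⟩ := Gn.exists_melonicMove hq (φ d)
  exact ⟨G₀, H, h₀, hm.tail hmove, h.isomorphic φ hφ hφ' hφv hins⟩

theorem Graph.isMin_of_ferm_eq_dishat (G : Graph q)
    (h : ∀ a, G.toPreGraph.dishat a = G.ferm a) : G.IsMin := by
  classical
  obtain ⟨a⟩ := G.nonemptyV
  refine ⟨a, G.dis a, (G.dis_fpf a).symm, fun v => ?_, rfl, fun m => (h (a, m)).symm⟩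
  have hiff : ∀ u, (G.dis u = a ∨ G.dis u = G.dis a) ↔ (u = a ∨ u = G.dis a) := by
    intro u
    rw [G.dis.injective.eq_iff, or_comm]
    refine or_congr_right ⟨fun e => ?_, fun e => ?_⟩
    · rw [← e, G.dis_invol]
    · rw [e, G.dis_invol]
  have := PreGraph.conn0_iff_colouring.1 G.conn
    (fun u => if u = a ∨ u = G.dis a then 1 else 0) (fun d => by
      rw [← h d, PreGraph.dishat_apply]
      simp only [hiff]) v a
  by_contra hv
  simp [hv] at this

theorem Graph.isMelonic_of_hasLocalCuts (hq : 2 ≤ q) (G : Graph q)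
    (h : G.toPreGraph.HasLocalCuts) : G.IsMelonic := by
  induction hn : Fintype.card G.V using Nat.strong_induction_on generalizing G with
  | _ n ih =>
    by_cases hne : ∃ a, G.toPreGraph.dishat a ≠ G.ferm a
    · obtain ⟨a, ha, hk⟩ := h.exists_melon hne
      obtain ⟨G', x, y, ι, d, m, hins⟩ := G.exists_isInsertion_of_melon a ha hk
      exact hins.isMelonic hq
        (ih _ (hn ▸ hins.card_lt) G' (hins.hasLocalCuts_iff.1 h) rfl)
    · push Not at hne
      exact ⟨G, G, G.isMin_of_ferm_eq_dishat hne, .refl, Equiv.refl _, fun _ => rfl,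
        fun _ => rfl, fun v => ⟨v, fun _ => rfl⟩⟩

end Melons

/-- For every integer `q ≥ 2`, an SYK graph `G` is melonic if
and only if every pair `{e₁, e₂}` of distinct fermionic lines of `G` belonging
to a common face is a 2-cut of `G` (i.e. of the multigraph `G⁺`). -/
theorem syk_melonic_iff_shared_face_pairs_are_two_cuts (q : ℕ) (hq : 2 ≤ q)
    (G : Graph q) :
    G.IsMelonic ↔
      ∀ e₁ e₂ : Set G.toPreGraph.Dart,
        G.toPreGraph.IsLine e₁ → G.toPreGraph.IsLine e₂ → e₁ ≠ e₂ →
        G.toPreGraph.LinesShareFace e₁ e₂ → G.toPreGraph.TwoCutPlus e₁ e₂ := by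
  rw [← PreGraph.hasLocalCuts_iff G.conn]
  exact ⟨Graph.IsMelonic.hasLocalCuts, G.isMelonic_of_hasLocalCuts hq⟩

end SYK
end
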